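/- Let A(B)^C be a C-Galois extension with canonical entwining map ψ, V a left C-comodule, E = A □_C V the cotensor product, and Hom_ψ(V,A) the space of linear maps φ : V → A with ψ(v₍₋₁₎ ⊗ φ(v₍₀₎)) = φ(v)1₍₀₎ ⊗ 1₍₁₎ for all v ∈ V. If A is flat as a right B-module (or V is coflat as a left C-comodule), then the right B-modules Hom_{B-}(E,B) (left B-module maps E → B, with (s·b)(x) = s(x)b) and Hom_ψ(V,A) (with (φ·b)(v) = φ(v)b) are isomorphic, via φ ↦ (Σᵢ aⁱ⊗vⁱ ↦ Σᵢ aⁱφ(vⁱ)). -/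

import Mathlib

open TensorProduct LinearMap

/-- An entwining structure `(A, C)_ψ`. -/
structure Entwining (k A C : Type) [Field k] [Ring A] [Algebra k A]
    [AddCommGroup C] [Module k C] [Coalgebra k C] where
  ψ : C ⊗[k] A →ₗ[k] A ⊗[k] C
  entw_mul : ψ ∘ₗ (mul' k A).lTensor C =
    (mul' k A).rTensor C ∘ₗ (TensorProduct.assoc k A A C).symm.toLinearMap ∘ₗ
      ψ.lTensor A ∘ₗ (TensorProduct.assoc k A C A).toLinearMap ∘ₗ
      ψ.rTensor A ∘ₗ (TensorProduct.assoc k C A A).symm.toLinearMap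
  entw_unit : ∀ c : C, ψ (c ⊗ₜ[k] 1) = 1 ⊗ₜ[k] c
  entw_comul : (Coalgebra.comul (R := k) (A := C)).lTensor A ∘ₗ ψ =
    (TensorProduct.assoc k A C C).toLinearMap ∘ₗ ψ.rTensor C ∘ₗ
      (TensorProduct.assoc k C A C).symm.toLinearMap ∘ₗ ψ.lTensor C ∘ₗ
      (TensorProduct.assoc k C C A).toLinearMap ∘ₗ
      (Coalgebra.comul (R := k) (A := C)).rTensor A
  entw_counit : (TensorProduct.rid k A).toLinearMap ∘ₗ
      (Coalgebra.counit (R := k) (A := C)).lTensor A ∘ₗ ψ =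
    (TensorProduct.lid k A).toLinearMap ∘ₗ (Coalgebra.counit (R := k) (A := C)).rTensor A

/-- A right `C`-comodule structure on `V`. -/
structure RComod (k C V : Type) [Field k] [AddCommGroup C] [Module k C] [Coalgebra k C]
    [AddCommGroup V] [Module k V] where
  ρ : V →ₗ[k] V ⊗[k] C
  coassoc : (Coalgebra.comul (R := k) (A := C)).lTensor V ∘ₗ ρ =
    (TensorProduct.assoc k V C C).toLinearMap ∘ₗ ρ.rTensor C ∘ₗ ρ
  counit_id : (TensorProduct.rid k V).toLinearMap ∘ₗ
      (Coalgebra.counit (R := k) (A := C)).lTensor V ∘ₗ ρ = LinearMap.id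

/-- A left `C`-comodule structure on `V`. -/
structure LComod (k C V : Type) [Field k] [AddCommGroup C] [Module k C] [Coalgebra k C]
    [AddCommGroup V] [Module k V] where
  ρ : V →ₗ[k] C ⊗[k] V
  coassoc : (Coalgebra.comul (R := k) (A := C)).rTensor V ∘ₗ ρ =
    (TensorProduct.assoc k C C V).symm.toLinearMap ∘ₗ ρ.lTensor C ∘ₗ ρ
  counit_id : (TensorProduct.lid k V).toLinearMap ∘ₗ
      (Coalgebra.counit (R := k) (A := C)).rTensor V ∘ₗ ρ = LinearMap.id

/-- A right `A`-module structure (`k`-linear) on `M`. -/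
structure RAct (k A M : Type) [Field k] [Ring A] [Algebra k A]
    [AddCommGroup M] [Module k M] where
  act : M ⊗[k] A →ₗ[k] M
  act_one : ∀ m : M, act (m ⊗ₜ[k] 1) = m
  act_mul : ∀ (m : M) (a b : A),
    act (act (m ⊗ₜ[k] a) ⊗ₜ[k] b) = act (m ⊗ₜ[k] (a * b))

variable {k A C M : Type} [Field k] [Ring A] [Algebra k A]
  [AddCommGroup C] [Module k C] [Coalgebra k C] [AddCommGroup M] [Module k M]

/-- The compatibility condition making `M` an entwined `(A,C)_ψ`-module. -/
def EntwCompat (E : Entwining k A C) (α : RAct k A M) (ρM : RComod k C M) : Prop :=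
  ρM.ρ ∘ₗ α.act = α.act.rTensor C ∘ₗ (TensorProduct.assoc k M A C).symm.toLinearMap ∘ₗ
    E.ψ.lTensor M ∘ₗ (TensorProduct.assoc k M C A).toLinearMap ∘ₗ ρM.ρ.rTensor A

/-- The `A`-action on `M ⊗ C` induced by an entwining: `(m⊗c)·a = m·a_α ⊗ c^α`. -/
noncomputable def entwAct (E : Entwining k A C) (ν : M ⊗[k] A →ₗ[k] M) :
    (M ⊗[k] C) ⊗[k] A →ₗ[k] M ⊗[k] C :=
  ν.rTensor C ∘ₗ (TensorProduct.assoc k M A C).symm.toLinearMap ∘ₗ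
    E.ψ.lTensor M ∘ₗ (TensorProduct.assoc k M C A).toLinearMap

/-- The `C`-coaction `M ⊗ Δ` on `M ⊗ C`. -/
noncomputable def coactMC (k C M : Type) [Field k] [AddCommGroup C] [Module k C]
    [Coalgebra k C] [AddCommGroup M] [Module k M] :
    M ⊗[k] C →ₗ[k] (M ⊗[k] C) ⊗[k] C :=
  (TensorProduct.assoc k M C C).symm.toLinearMap ∘ₗ
    (Coalgebra.comul (R := k) (A := C)).lTensor M

/-- The coaction on `V ⊗ A` induced by an entwining: `v⊗a ↦ v₍₀₎ ⊗ ψ(v₍₁₎⊗a)`. -/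
noncomputable def entwCoact {V : Type} [AddCommGroup V] [Module k V]
    (E : Entwining k A C) (ρV : V →ₗ[k] V ⊗[k] C) :
    V ⊗[k] A →ₗ[k] (V ⊗[k] A) ⊗[k] C :=
  (TensorProduct.assoc k V A C).symm.toLinearMap ∘ₗ E.ψ.lTensor V ∘ₗ
    (TensorProduct.assoc k V C A).toLinearMap ∘ₗ ρV.rTensor A

/-- The action `V ⊗ μ` on `V ⊗ A`. -/
noncomputable def actVA (k : Type) (A V : Type) [Field k] [Ring A] [Algebra k A]
    [AddCommGroup V] [Module k V] :
    (V ⊗[k] A) ⊗[k] A →ₗ[k] V ⊗[k] A :=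
  (mul' k A).lTensor V ∘ₗ (TensorProduct.assoc k V A A).toLinearMap

/-- The canonical map `A ⊗ₖ A → A ⊗ C`, `a ⊗ a' ↦ a a'₍₀₎ ⊗ a'₍₁₎`. -/
noncomputable def canHat (ΔA : A →ₗ[k] A ⊗[k] C) : A ⊗[k] A →ₗ[k] A ⊗[k] C :=
  (mul' k A).rTensor C ∘ₗ (TensorProduct.assoc k A A C).symm.toLinearMap ∘ₗ ΔA.lTensor A

/-- The subspace of relations defining `A ⊗_B A` inside `A ⊗ₖ A`. -/
noncomputable def relSub (k : Type) [Field k] {A : Type} [Ring A] [Algebra k A]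
    (B : Set A) : Submodule k (A ⊗[k] A) :=
  Submodule.span k {x | ∃ a a' b : A, b ∈ B ∧ x = (a * b) ⊗ₜ[k] a' - a ⊗ₜ[k] (b * a')}

/-- Convolution product of `f g : C → A`. -/
noncomputable def conv (f g : C →ₗ[k] A) : C →ₗ[k] A :=
  mul' k A ∘ₗ TensorProduct.map f g ∘ₗ Coalgebra.comul (R := k)

/-- The convolution unit `η ∘ ε`. -/
noncomputable def convUnit (k C A : Type) [Field k] [Ring A] [Algebra k A]
    [AddCommGroup C] [Module k C] [Coalgebra k C] : C →ₗ[k] A :=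
  Algebra.linearMap k A ∘ₗ Coalgebra.counit (R := k)

variable (k) in
/-- The subalgebra-defining set `B = {b ∈ A : ∀ a, Δ_A(ba) = bΔ_A(a)}`. -/
noncomputable def coinvB (ΔA : A →ₗ[k] A ⊗[k] C) : Set A :=
  {b | ∀ a : A, ΔA (b * a) = (LinearMap.mulLeft k b).rTensor C (ΔA a)}

/-- `A` as a right module over itself. -/
noncomputable def mulRAct (k A : Type) [Field k] [Ring A] [Algebra k A] : RAct k A A where
  act := mul' k A
  act_one := fun m => by simp [LinearMap.mul'_apply]
  act_mul := fun m a b => by simp [LinearMap.mul'_apply, mul_assoc]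

variable (k) in
/-- The cotensor product `W □_C V` inside `W ⊗ V`. -/
noncomputable def cotensor {W V : Type} [AddCommGroup W] [Module k W]
    [AddCommGroup V] [Module k V] (ρW : W →ₗ[k] W ⊗[k] C) (lamV : V →ₗ[k] C ⊗[k] V) :
    Submodule k (W ⊗[k] V) :=
  LinearMap.ker
    ((TensorProduct.assoc k W C V).toLinearMap ∘ₗ ρW.rTensor V - lamV.lTensor W)

variable (k) in
/-- The `B`-balancing relations inside `A ⊗ₖ I` for a left ideal `I` of `B ⊆ A`. -/
noncomputable def idealRelR (B : Set A) (I : Submodule k A) : Submodule k (A ⊗[k] ↥I) :=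
  Submodule.span k {z | ∃ (a b : A) (x : I), b ∈ B ∧ ∃ h : b * (x : A) ∈ I,
    z = a ⊗ₜ[k] (⟨b * (x : A), h⟩ : I) - (a * b) ⊗ₜ[k] x}

variable (k) in
/-- `A` is a flat right module over the subalgebra determined by `B ⊆ A`
(standard left-ideal criterion). -/
def FlatRightOver (B : Set A) : Prop :=
  ∀ I : Submodule k A, (I : Set A) ⊆ B → (∀ x ∈ I, ∀ b ∈ B, b * x ∈ I) →
    LinearMap.ker (mul' k A ∘ₗ I.subtype.lTensor A) = idealRelR k B I

variable (k) in
/-- The left `C`-comodule `V` (with coaction `lamV`) is coflat: the cotensor product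
`− □_C V` preserves exactness of sequences of right `C`-comodules. -/
def IsCoflat {V : Type} [AddCommGroup V] [Module k V] (lamV : V →ₗ[k] C ⊗[k] V) : Prop :=
  ∀ (W W' W'' : Type) [AddCommGroup W] [Module k W] [AddCommGroup W'] [Module k W']
    [AddCommGroup W''] [Module k W'']
    (ρ : RComod k C W) (ρ' : RComod k C W') (ρ'' : RComod k C W'')
    (f : W' →ₗ[k] W) (g : W →ₗ[k] W''),
    ρ.ρ ∘ₗ f = f.rTensor C ∘ₗ ρ'.ρ →
    ρ''.ρ ∘ₗ g = g.rTensor C ∘ₗ ρ.ρ →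
    LinearMap.range f = LinearMap.ker g →
    Submodule.map (f.rTensor V) (cotensor k ρ'.ρ lamV) =
      cotensor k ρ.ρ lamV ⊓ LinearMap.ker (g.rTensor V)

set_option linter.unusedSectionVars false

section ModuleFlatness

variable {N L : Type} [AddCommGroup N] [Module k N] [Module A N] [IsScalarTower k A N]
  [AddCommGroup L] [Module k L]

variable (k A N) in
/-- The action `A ⊗ N → N` of `A` on a left `A`-module. -/
noncomputable def actionMap : A ⊗[k] N →ₗ[k] N :=
  TensorProduct.lift (Algebra.lsmul k k N).toLinearMap

@[simp]
theorem actionMap_tmul (a : A) (n : N) : actionMap k A N (a ⊗ₜ[k] n) = a • n := rfl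

/-- The `B`-balancing relations in `A ⊗ L`, where the (partial) left action of `B` on `L` is the
one induced from `N` along `f : L → N`. -/
def balRel (B : Subalgebra k A) (f : L →ₗ[k] N) : Submodule k (A ⊗[k] L) :=
  Submodule.span k {w | ∃ a b : A, b ∈ B ∧ ∃ x y : L, f y = b • f x ∧
    w = (a * b) ⊗ₜ[k] x - a ⊗ₜ[k] y}

/-- The linear dual of `A`, with the left `B`-action coming from right multiplication on `A`. -/
@[reducible]
noncomputable def dualModule (B : Subalgebra k A) : Module B (A →ₗ[k] k) where
  smul b f := f ∘ₗ mulRight k (b : A)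
  one_smul f := by ext a; exact congrArg f (mul_one a)
  mul_smul b c f := by ext a; exact congrArg f (mul_assoc a b c).symm
  smul_zero b := by ext a; rfl
  smul_add b f g := by ext a; rfl
  add_smul b c f := by
    ext a
    exact (congrArg f (mul_add a (b : A) (c : A))).trans (map_add f _ _)
  zero_smul f := by
    ext a
    exact (congrArg f (mul_zero a)).trans (map_zero f)

theorem dualModule_algebraMap_smul (B : Subalgebra k A) (c : k) (f : A →ₗ[k] k) :
    letI := dualModule B
    algebraMap k B c • f = c • f := by
  ext a
  change f (a * algebraMap k A c) = c • f a
  rw [← Algebra.commutes, ← Algebra.smul_def, map_smul]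

theorem dualModule_baer {B : Subalgebra k A} (hB : FlatRightOver k (B : Set A)) :
    letI := dualModule B
    Module.Baer B (A →ₗ[k] k) := by
  let _ := dualModule B
  have smul_def : ∀ (b : B) (f : A →ₗ[k] k) (a : A), (b • f) a = f (a * b) := fun _ _ _ => rfl
  intro I g
  let J : Submodule k A := (I.restrictScalars k).map B.val.toLinearMap
  have memJ : ∀ x ∈ J, ∃ h : x ∈ B, (⟨x, h⟩ : B) ∈ I := by
    rintro _ ⟨y, hy, rfl⟩
    exact ⟨y.2, hy⟩
  let gJ : J →ₗ[k] (A →ₗ[k] k) :=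
    { toFun := fun x => g ⟨⟨x, (memJ x x.2).1⟩, (memJ x x.2).2⟩
      map_add' := fun x y => by rw [← map_add]; rfl
      map_smul' := fun c x => by
        have h := g.map_smul (algebraMap k B c) ⟨⟨x, (memJ x x.2).1⟩, (memJ x x.2).2⟩
        rw [dualModule_algebraMap_smul] at h
        rw [RingHom.id_apply, ← h]
        congr 1
        ext
        exact Algebra.smul_def c (x : A) }
  let F : A ⊗[k] J →ₗ[k] k := TensorProduct.lift gJ.flip
  have hF : LinearMap.ker (mul' k A ∘ₗ J.subtype.lTensor A) ≤ LinearMap.ker F := by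
    rw [hB J (fun x hx => (memJ x hx).1) (fun x hx b hb => ?_), idealRelR, Submodule.span_le]
    · rintro _ ⟨a, b, x, hb, h, rfl⟩
      have := g.map_smul ⟨b, hb⟩ ⟨⟨x, (memJ x x.2).1⟩, (memJ x x.2).2⟩
      have h' := LinearMap.congr_fun this a
      rw [smul_def] at h'
      simp only [SetLike.mem_coe, LinearMap.mem_ker, map_sub, sub_eq_zero]
      exact h'
    · obtain ⟨h, h'⟩ := memJ x hx
      exact ⟨⟨b, hb⟩ * ⟨x, h⟩, I.mul_mem_left _ h', rfl⟩
  let m : A ⊗[k] J →ₗ[k] A := mul' k A ∘ₗ J.subtype.lTensor A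
  obtain ⟨H, hH⟩ : ∃ H : A →ₗ[k] k, H ∘ₗ m = F := by
    have := LinearMap.range_dualMap_eq_dualAnnihilator_ker m
    have h2 : F ∈ LinearMap.range m.dualMap := by
      rw [this, Submodule.mem_dualAnnihilator]
      exact fun w hw => hF hw
    exact h2
  refine ⟨LinearMap.toSpanSingleton B (A →ₗ[k] k) H, fun x hx => ?_⟩
  ext a
  have := LinearMap.congr_fun hH (a ⊗ₜ[k] (⟨x, ⟨x, hx, rfl⟩⟩ : J))
  exact this

/-- Flatness passes from left ideals to arbitrary `B`-stable subspaces of `A`-modules. -/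
theorem FlatRightOver.mem_balRel {B : Subalgebra k A} (hB : FlatRightOver k (B : Set A))
    (L : Submodule k N) (hL : ∀ b ∈ B, ∀ x ∈ L, b • x ∈ L) (z : A ⊗[k] L)
    (hz : L.subtype.lTensor A z ∈ balRel B (LinearMap.id : N →ₗ[k] N)) :
    z ∈ balRel B L.subtype := by
  by_contra hcon
  obtain ⟨F, hFz, hF⟩ := Submodule.exists_le_ker_of_notMem hcon
  let _ := dualModule B
  have smul_def : ∀ (b : B) (f : A →ₗ[k] k) (a : A), (b • f) a = f (a * b) := fun _ _ _ => rfl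
  let LB : Submodule B N :=
    { carrier := L
      add_mem' := L.add_mem
      zero_mem' := L.zero_mem
      smul_mem' := fun b x hx => hL b b.2 x hx }
  let g : LB →ₗ[B] (A →ₗ[k] k) :=
    { toFun := fun x => (TensorProduct.curry F).flip (⟨x, x.2⟩ : L)
      map_add' := fun x y => by rw [← map_add]; rfl
      map_smul' := fun b x => by
        ext a
        have : (a * b) ⊗ₜ[k] (⟨x, x.2⟩ : L) - a ⊗ₜ[k] (⟨(b : A) • (x : N), hL b b.2 x x.2⟩ : L) ∈
            balRel B L.subtype :=
          Submodule.subset_span ⟨a, b, b.2, _, _, rfl, rfl⟩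
        have h := hF this
        rw [LinearMap.mem_ker, map_sub, sub_eq_zero] at h
        exact h.symm }
  obtain ⟨G, hG⟩ := (dualModule_baer hB).extension_property LB.subtype
    (Submodule.injective_subtype _) g
  let Gk : N →ₗ[k] (A →ₗ[k] k) :=
    { toFun := G
      map_add' := G.map_add
      map_smul' := fun c n => by
        rw [RingHom.id_apply, ← dualModule_algebraMap_smul, ← G.map_smul]
        exact congrArg G (algebraMap_smul A c n).symm }
  let H : A ⊗[k] N →ₗ[k] k := TensorProduct.lift Gk.flip
  have hH : balRel B (LinearMap.id : N →ₗ[k] N) ≤ LinearMap.ker H := by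
    rw [balRel, Submodule.span_le]
    rintro _ ⟨a, b, hb, x, y, hxy, rfl⟩
    rw [LinearMap.id_apply, LinearMap.id_apply] at hxy
    subst hxy
    have h' := LinearMap.congr_fun (G.map_smul ⟨b, hb⟩ x) a
    rw [smul_def] at h'
    simp only [SetLike.mem_coe, LinearMap.mem_ker, map_sub, sub_eq_zero]
    exact h'.symm
  have hHF : H ∘ₗ L.subtype.lTensor A = F := by
    ext a x
    exact LinearMap.congr_fun (LinearMap.congr_fun hG (⟨x, x.2⟩ : LB)) a
  exact hFz (by rw [← hHF]; exact hH hz)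

end ModuleFlatness

section Canonical

variable {N N' V W : Type} [AddCommGroup N] [Module k N] [Module A N] [IsScalarTower k A N]
  [AddCommGroup N'] [Module k N'] [Module A N'] [IsScalarTower k A N']
  [AddCommGroup V] [Module k V] [AddCommGroup W] [Module k W]

theorem actionMap_lTensor (h : N →ₗ[k] N') (hh : ∀ (a : A) (n : N), h (a • n) = a • h n)
    (z : A ⊗[k] N) : actionMap k A N' (h.lTensor A z) = h (actionMap k A N z) := by
  induction z with
  | zero => simp
  | tmul a n => simp [hh]
  | add x y hx hy => simp only [map_add, hx, hy]

theorem actionMap_smul (a : A) (z : A ⊗[k] N) :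
    actionMap k A N (a • z) = a • actionMap k A N z := by
  induction z with
  | zero => simp
  | tmul a' n => simp [smul_tmul', mul_smul]
  | add x y hx hy => simp only [smul_add, map_add, hx, hy]

theorem lTensor_smul_left {V W : Type} [AddCommMonoid V] [Module k V] [AddCommMonoid W] [Module k W]
    (h : V →ₗ[k] W) (a : A) (z : A ⊗[k] V) :
    h.lTensor A (a • z) = a • h.lTensor A z := by
  induction z with
  | zero => simp
  | tmul a' n => simp [smul_tmul']
  | add x y hx hy => simp only [smul_add, map_add, hx, hy]

theorem mulLeft_rTensor (a : A) (z : A ⊗[k] V) :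
    (LinearMap.mulLeft k a).rTensor V z = a • z := by
  induction z with
  | zero => simp
  | tmul a' n => simp [smul_tmul']
  | add x y hx hy => simp only [smul_add, map_add, hx, hy]

theorem assoc_smul_tmul (a : A) (t : A ⊗[k] C) (v : V) :
    TensorProduct.assoc k A C V ((a • t) ⊗ₜ[k] v) =
      a • TensorProduct.assoc k A C V (t ⊗ₜ[k] v) := by
  induction t with
  | zero => simp
  | tmul a' n => simp [smul_tmul']
  | add x y hx hy => simp only [smul_add, map_add, add_tmul, hx, hy]

/-- The set `coinvB` as a subalgebra of `A`. -/
noncomputable def coinvSubalgebra (ρA : A →ₗ[k] A ⊗[k] C) : Subalgebra k A where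
  carrier := coinvB k ρA
  mul_mem' {b c} hb hc a := by
    have hb := hb (c * a)
    have hc := hc a
    rw [mulLeft_rTensor] at hb hc ⊢
    rw [mul_assoc, hb, hc, mul_smul]
  add_mem' {b c} hb hc a := by
    have hb := hb a
    have hc := hc a
    rw [mulLeft_rTensor] at hb hc ⊢
    rw [add_mul, map_add, hb, hc, add_smul]
  algebraMap_mem' r a := by
    rw [mulLeft_rTensor, ← Algebra.smul_def, map_smul, algebraMap_smul]

theorem map_mul_of_mem_coinv {ρA : A →ₗ[k] A ⊗[k] C} {b : A} (hb : b ∈ coinvSubalgebra ρA)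
    (a : A) : ρA (b * a) = b • ρA a := by
  rw [← mulLeft_rTensor]
  exact hb a

/-- The map `W ⊗ V → W ⊗ (C ⊗ V)` induced by a map `W → W ⊗ C`. -/
noncomputable def coactLeft (V : Type) [AddCommGroup V] [Module k V]
    (ρW : W →ₗ[k] W ⊗[k] C) : W ⊗[k] V →ₗ[k] W ⊗[k] (C ⊗[k] V) :=
  (TensorProduct.assoc k W C V).toLinearMap ∘ₗ ρW.rTensor V

theorem mem_cotensor {ρW : W →ₗ[k] W ⊗[k] C} {lamV : V →ₗ[k] C ⊗[k] V} {x : W ⊗[k] V} :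
    x ∈ cotensor k ρW lamV ↔ coactLeft V ρW x = lamV.lTensor W x := by
  rw [cotensor, LinearMap.mem_ker, LinearMap.sub_apply, sub_eq_zero]
  rfl

theorem coactLeft_smul {ρA : A →ₗ[k] A ⊗[k] C} {b : A} (hb : b ∈ coinvSubalgebra ρA)
    (z : A ⊗[k] V) : coactLeft V ρA (b • z) = b • coactLeft V ρA z := by
  induction z with
  | zero => simp
  | tmul a v =>
    simp only [coactLeft, smul_tmul', smul_eq_mul, LinearMap.comp_apply, LinearMap.rTensor_tmul,
      map_mul_of_mem_coinv hb, LinearEquiv.coe_coe, assoc_smul_tmul]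
  | add x y hx hy => simp only [smul_add, map_add, hx, hy]

theorem coactLeft_lTensor (ρW : W →ₗ[k] W ⊗[k] C) {V' : Type} [AddCommGroup V'] [Module k V']
    (h : V →ₗ[k] V') (z : W ⊗[k] V) :
    coactLeft V' ρW (h.lTensor W z) = (h.lTensor C).lTensor W (coactLeft V ρW z) := by
  induction z with
  | zero => simp
  | tmul a v =>
    simp only [coactLeft, LinearMap.comp_apply, LinearMap.rTensor_tmul, LinearMap.lTensor_tmul,
      LinearEquiv.coe_coe]
    generalize ρW a = t
    induction t with
    | zero => simp
    | tmul a v => simp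
    | add x y hx hy => simp only [map_add, add_tmul, hx, hy]
  | add x y hx hy => simp only [map_add, hx, hy]

theorem coactLeft_coactLeft (ρW : RComod k C W) (z : W ⊗[k] V) :
    coactLeft (C ⊗[k] V) ρW.ρ (coactLeft V ρW.ρ z) =
      (coactLeft V (Coalgebra.comul (R := k) (A := C))).lTensor W (coactLeft V ρW.ρ z) := by
  induction z with
  | zero => simp
  | tmul w v =>
    have h := LinearMap.congr_fun ρW.coassoc w
    simp only [LinearMap.comp_apply, LinearEquiv.coe_coe] at h
    have h1 : ∀ t : W ⊗[k] C, coactLeft (C ⊗[k] V) ρW.ρ (TensorProduct.assoc k W C V (t ⊗ₜ v)) =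
        (TensorProduct.assoc k C C V).toLinearMap.lTensor W (TensorProduct.assoc k W (C ⊗[k] C) V
          (TensorProduct.assoc k W C C (ρW.ρ.rTensor C t) ⊗ₜ[k] v)) := by
      intro t
      induction t with
      | zero => simp
      | tmul a c =>
        simp only [coactLeft, LinearMap.comp_apply, LinearMap.rTensor_tmul,
          LinearEquiv.coe_coe, TensorProduct.assoc_tmul]
        generalize ρW.ρ a = u
        induction u with
        | zero => simp
        | tmul a v => simp
        | add x y hx hy => simp only [map_add, add_tmul, hx, hy]
      | add x y hx hy => simp only [map_add, add_tmul, hx, hy]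
    have h2 : ∀ t : W ⊗[k] C, (coactLeft V (Coalgebra.comul (R := k) (A := C))).lTensor W
          (TensorProduct.assoc k W C V (t ⊗ₜ v)) =
        (TensorProduct.assoc k C C V).toLinearMap.lTensor W (TensorProduct.assoc k W (C ⊗[k] C) V
          ((Coalgebra.comul (R := k) (A := C)).lTensor W t ⊗ₜ[k] v)) := by
      intro t
      induction t with
      | zero => simp
      | tmul a c => simp [coactLeft]
      | add x y hx hy => simp only [map_add, add_tmul, hx, hy]
    have h3 : coactLeft V ρW.ρ (w ⊗ₜ[k] v) = TensorProduct.assoc k W C V (ρW.ρ w ⊗ₜ v) := rfl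
    rw [h3, h1, h2, h]
  | add x y hx hy => simp only [map_add, hx, hy]

theorem LComod.coactLeft_comul (lamV : LComod k C V) (v : V) :
    coactLeft V (Coalgebra.comul (R := k) (A := C)) (lamV.ρ v) = lamV.ρ.lTensor C (lamV.ρ v) := by
  have h := LinearMap.congr_fun lamV.coassoc v
  simp only [LinearMap.comp_apply, LinearEquiv.coe_coe] at h
  simp [coactLeft, h]

theorem LComod.lTensor_injective (lamV : LComod k C V) (X : Type) [AddCommGroup X] [Module k X] :
    Function.Injective (lamV.ρ.lTensor X) := by
  apply Module.Flat.lTensor_preserves_injective_linearMap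
  intro v w h
  have hid := LinearMap.congr_fun lamV.counit_id
  simp only [LinearMap.comp_apply, LinearMap.id_apply] at hid
  rw [← hid v, h, hid]

/-- The canonical map tensored with `V`, `a ⊗ (a' ⊗ v) ↦ a a'₍₀₎ ⊗ (a'₍₁₎ ⊗ v)`. -/
noncomputable def canLeft (V : Type) [AddCommGroup V] [Module k V] (ρA : A →ₗ[k] A ⊗[k] C) :
    A ⊗[k] (A ⊗[k] V) →ₗ[k] A ⊗[k] (C ⊗[k] V) :=
  actionMap k A (A ⊗[k] (C ⊗[k] V)) ∘ₗ (coactLeft V ρA).lTensor A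

theorem canHat_tmul (ρA : A →ₗ[k] A ⊗[k] C) (a a' : A) :
    canHat ρA (a ⊗ₜ[k] a') = a • ρA a' := by
  simp only [canHat, LinearMap.comp_apply, LinearMap.lTensor_tmul, LinearEquiv.coe_coe]
  generalize ρA a' = t
  induction t with
  | zero => simp
  | tmul a v => simp [smul_tmul']
  | add x y hx hy => simp only [map_add, tmul_add, smul_add, hx, hy]

theorem canLeft_assoc (ρA : A →ₗ[k] A ⊗[k] C) (z : (A ⊗[k] A) ⊗[k] V) :
    canLeft V ρA (TensorProduct.assoc k A A V z) =
      TensorProduct.assoc k A C V ((canHat ρA).rTensor V z) := by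
  induction z with
  | zero => simp
  | tmul t v =>
    induction t with
    | zero => simp
    | tmul a a' =>
      simp [canLeft, coactLeft, canHat_tmul, assoc_smul_tmul]
    | add x y hx hy => simp only [map_add, add_tmul, hx, hy]
  | add x y hx hy => simp only [map_add, hx, hy]

theorem canLeft_surjective {ρA : A →ₗ[k] A ⊗[k] C} (hsurj : Function.Surjective (canHat ρA)) :
    Function.Surjective (canLeft V ρA) := by
  intro y
  obtain ⟨z, hz⟩ := LinearMap.rTensor_surjective V hsurj ((TensorProduct.assoc k A C V).symm y)
  exact ⟨TensorProduct.assoc k A A V z, by rw [canLeft_assoc, hz, LinearEquiv.apply_symm_apply]⟩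

theorem canLeft_eq_zero_of_mem_balRel {ρA : A →ₗ[k] A ⊗[k] C} {z : A ⊗[k] (A ⊗[k] V)}
    (hz : z ∈ balRel (coinvSubalgebra ρA) (LinearMap.id : A ⊗[k] V →ₗ[k] A ⊗[k] V)) :
    canLeft V ρA z = 0 := by
  suffices h : balRel (coinvSubalgebra ρA) (LinearMap.id : A ⊗[k] V →ₗ[k] A ⊗[k] V) ≤
    LinearMap.ker (canLeft V ρA) from h hz
  rw [balRel, Submodule.span_le]
  rintro _ ⟨a, b, hb, x, y, hxy, rfl⟩
  simp only [LinearMap.id_apply] at hxy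
  subst hxy
  simp [canLeft, coactLeft_smul hb, mul_smul]

theorem mem_balRel_of_canLeft_eq_zero {ρA : A →ₗ[k] A ⊗[k] C}
    (hsurj : Function.Surjective (canHat ρA))
    (hker : LinearMap.ker (canHat ρA) = relSub k (coinvB k ρA))
    {z : A ⊗[k] (A ⊗[k] V)} (hz : canLeft V ρA z = 0) :
    z ∈ balRel (coinvSubalgebra ρA) (LinearMap.id : A ⊗[k] V →ₗ[k] A ⊗[k] V) := by
  obtain ⟨z, rfl⟩ := (TensorProduct.assoc k A A V).surjective z
  rw [canLeft_assoc, LinearEquiv.map_eq_zero_iff] at hz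
  have hex : Function.Exact (relSub k (coinvB k ρA)).subtype (canHat ρA) := by
    rw [LinearMap.exact_iff, Submodule.range_subtype, hker]
  obtain ⟨w, rfl⟩ := (rTensor_exact V hex hsurj z).1 hz
  clear hz
  induction w with
  | zero => simp
  | tmul t v =>
    obtain ⟨t, ht⟩ := t
    simp only [LinearMap.rTensor_tmul, Submodule.subtype_apply]
    induction ht using Submodule.span_induction with
    | mem x h =>
      obtain ⟨a, a', b, hb, rfl⟩ := h
      refine Submodule.subset_span ⟨a, b, hb, a' ⊗ₜ v, (b * a') ⊗ₜ v, ?_, ?_⟩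
      · simp [smul_tmul']
      · simp [sub_tmul]
    | zero => simp
    | add x y _ _ hx hy =>
      rw [add_tmul, map_add]
      exact add_mem hx hy
    | smul c x _ hx =>
      rw [← smul_tmul', map_smul]
      exact Submodule.smul_mem _ _ hx
  | add x y hx hy =>
    rw [map_add, map_add]
    exact add_mem hx hy

end Canonical

section Cotensor

variable {V W X : Type} [AddCommGroup V] [Module k V] [AddCommGroup W] [Module k W]
  [AddCommGroup X] [Module k X]

theorem smul_mem_cotensor {ρA : A →ₗ[k] A ⊗[k] C} (lamV : V →ₗ[k] C ⊗[k] V) {b : A}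
    (hb : b ∈ coinvSubalgebra ρA) {x : A ⊗[k] V} (hx : x ∈ cotensor k ρA lamV) :
    b • x ∈ cotensor k ρA lamV := by
  rw [mem_cotensor] at hx ⊢
  rw [coactLeft_smul hb, lTensor_smul_left, hx]

theorem canLeft_lTensor_cotensor {ρA : A →ₗ[k] A ⊗[k] C} {lamV : V →ₗ[k] C ⊗[k] V}
    (e : A ⊗[k] cotensor k ρA lamV) :
    canLeft V ρA ((cotensor k ρA lamV).subtype.lTensor A e) =
      lamV.lTensor A (actionMap k A _ ((cotensor k ρA lamV).subtype.lTensor A e)) := by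
  induction e with
  | zero => simp
  | tmul a x =>
    simp [canLeft, mem_cotensor.1 x.2, lTensor_smul_left]
  | add x y hx hy => simp only [map_add, hx, hy]

theorem exact_lTensor_cotensor (X : Type) [AddCommGroup X] [Module k X]
    (ρW : W →ₗ[k] W ⊗[k] C) (lamV : V →ₗ[k] C ⊗[k] V) :
    Function.Exact ((cotensor k ρW lamV).subtype.lTensor X)
      ((coactLeft V ρW - lamV.lTensor W).lTensor X) := by
  apply Module.Flat.lTensor_exact
  rw [LinearMap.exact_iff, Submodule.range_subtype]
  rfl

theorem balRel_rangeRestrict_le {N N' : Type} [AddCommGroup N] [Module k N] [Module A N]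
    [AddCommGroup N'] [Module k N'] [Module A N'] (B : Subalgebra k A) (g : N →ₗ[k] N')
    (hg : ∀ b ∈ B, ∀ n, g (b • n) = b • g n) :
    balRel B (LinearMap.range g).subtype ≤
      (balRel B (LinearMap.id : N →ₗ[k] N)).map (g.rangeRestrict.lTensor A) := by
  rw [balRel, Submodule.span_le]
  rintro _ ⟨a, b, hb, ⟨_, x, rfl⟩, y, hxy, rfl⟩
  refine ⟨(a * b) ⊗ₜ x - a ⊗ₜ (b • x), Submodule.subset_span ⟨a, b, hb, x, b • x, rfl, rfl⟩, ?_⟩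
  rw [map_sub, LinearMap.lTensor_tmul, LinearMap.lTensor_tmul]
  congr 2
  exact Subtype.ext ((hg b hb x).trans hxy.symm)

/-- `A · (A □_C V)` is all of `A ⊗ V` if `A` is flat over the coinvariants. -/
theorem cotensor_generates_of_flat (ΔA : RComod k C A)
    (hsurj : Function.Surjective (canHat ΔA.ρ))
    (hker : LinearMap.ker (canHat ΔA.ρ) = relSub k (coinvB k ΔA.ρ))
    (lamV : LComod k C V) (hflat : FlatRightOver k (coinvB k ΔA.ρ)) (y : A ⊗[k] V) :
    ∃ e : A ⊗[k] cotensor k ΔA.ρ lamV.ρ,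
      actionMap k A _ ((cotensor k ΔA.ρ lamV.ρ).subtype.lTensor A e) = y := by
  let g : A ⊗[k] V →ₗ[k] A ⊗[k] (C ⊗[k] V) := coactLeft V ΔA.ρ - lamV.ρ.lTensor A
  have hg : ∀ b ∈ coinvSubalgebra ΔA.ρ, ∀ n, g (b • n) = b • g n := fun b hb n => by
    simp only [g, LinearMap.sub_apply, coactLeft_smul hb, lTensor_smul_left, smul_sub]
  obtain ⟨z, hz⟩ := canLeft_surjective (V := V) hsurj (lamV.ρ.lTensor A y)
  have h1 : ∀ z, canLeft (C ⊗[k] V) ΔA.ρ ((coactLeft V ΔA.ρ).lTensor A z) =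
      (coactLeft V (Coalgebra.comul (R := k) (A := C))).lTensor A (canLeft V ΔA.ρ z) := by
    intro z
    induction z with
    | zero => simp
    | tmul a x => simp [canLeft, coactLeft_coactLeft, lTensor_smul_left]
    | add x y hx hy => simp only [map_add, hx, hy]
  have h2 : ∀ z, canLeft (C ⊗[k] V) ΔA.ρ ((lamV.ρ.lTensor A).lTensor A z) =
      (lamV.ρ.lTensor C).lTensor A (canLeft V ΔA.ρ z) := by
    intro z
    induction z with
    | zero => simp
    | tmul a x => simp [canLeft, coactLeft_lTensor, lTensor_smul_left]
    | add x y hx hy => simp only [map_add, hx, hy]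
  have h0 : canLeft (C ⊗[k] V) ΔA.ρ (g.lTensor A z) = 0 := by
    rw [LinearMap.lTensor_sub, LinearMap.sub_apply, map_sub, h1, h2, hz, sub_eq_zero,
      ← LinearMap.comp_apply, ← LinearMap.comp_apply, ← LinearMap.lTensor_comp,
      ← LinearMap.lTensor_comp]
    congr 2
    ext v
    exact lamV.coactLeft_comul v
  have h3 := FlatRightOver.mem_balRel (B := coinvSubalgebra ΔA.ρ) hflat (LinearMap.range g)
    (by rintro b hb _ ⟨x, rfl⟩; exact ⟨b • x, hg b hb x⟩) (g.rangeRestrict.lTensor A z) (by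
      rw [← LinearMap.comp_apply, ← LinearMap.lTensor_comp]
      exact mem_balRel_of_canLeft_eq_zero hsurj hker h0)
  obtain ⟨r, hr, hrz⟩ := balRel_rangeRestrict_le _ g hg h3
  have h4 : g.lTensor A (z - r) = 0 := by
    have : g = (LinearMap.range g).subtype ∘ₗ g.rangeRestrict := rfl
    rw [this, LinearMap.lTensor_comp, LinearMap.comp_apply, map_sub, hrz, sub_self, map_zero]
  obtain ⟨e, he⟩ := (exact_lTensor_cotensor A ΔA.ρ lamV.ρ (z - r)).1 h4
  refine ⟨e, lamV.lTensor_injective A ?_⟩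
  rw [← canLeft_lTensor_cotensor, he, map_sub, canLeft_eq_zero_of_mem_balRel hr, sub_zero, hz]

/-- If `A` is flat over the coinvariants, `A ⊗_B (A □_C V) → A ⊗ V` is injective. -/
theorem mem_balRel_cotensor_of_flat (ΔA : RComod k C A)
    (hsurj : Function.Surjective (canHat ΔA.ρ))
    (hker : LinearMap.ker (canHat ΔA.ρ) = relSub k (coinvB k ΔA.ρ))
    (lamV : LComod k C V) (hflat : FlatRightOver k (coinvB k ΔA.ρ))
    (e : A ⊗[k] cotensor k ΔA.ρ lamV.ρ)
    (he : actionMap k A _ ((cotensor k ΔA.ρ lamV.ρ).subtype.lTensor A e) = 0) :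
    e ∈ balRel (N := A ⊗[k] V) (L := cotensor k ΔA.ρ lamV.ρ) (coinvSubalgebra ΔA.ρ)
      (cotensor k ΔA.ρ lamV.ρ).subtype := by
  refine FlatRightOver.mem_balRel hflat _ (fun b hb x hx => smul_mem_cotensor _ hb hx) e
    (mem_balRel_of_canLeft_eq_zero hsurj hker ?_)
  rw [canLeft_lTensor_cotensor, he, map_zero]

/-- The right comodule `X ⊗ W`, with coaction on the second factor. -/
noncomputable def RComod.leftTensor (X : Type) [AddCommGroup X] [Module k X] (ρW : RComod k C W) :
    RComod k C (X ⊗[k] W) where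
  ρ := (TensorProduct.assoc k X W C).symm.toLinearMap ∘ₗ ρW.ρ.lTensor X
  coassoc := by
    ext x w
    have h := LinearMap.congr_fun ρW.coassoc w
    simp only [LinearMap.comp_apply, LinearEquiv.coe_coe] at h
    have h1 : ∀ t : W ⊗[k] C, (Coalgebra.comul (R := k) (A := C)).lTensor (X ⊗[k] W)
        ((TensorProduct.assoc k X W C).symm (x ⊗ₜ[k] t)) =
        (TensorProduct.assoc k X W (C ⊗[k] C)).symm
          (x ⊗ₜ (Coalgebra.comul (R := k) (A := C)).lTensor W t) := by
      intro t
      induction t with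
      | zero => simp
      | tmul w c =>
        simp only [TensorProduct.assoc_symm_tmul, LinearMap.lTensor_tmul]
      | add x y hx hy => simp only [map_add, tmul_add, hx, hy]
    have h2 : ∀ t : W ⊗[k] C, TensorProduct.assoc k (X ⊗[k] W) C C
        (((TensorProduct.assoc k X W C).symm.toLinearMap ∘ₗ ρW.ρ.lTensor X).rTensor C
          ((TensorProduct.assoc k X W C).symm (x ⊗ₜ[k] t))) =
        (TensorProduct.assoc k X W (C ⊗[k] C)).symm
          (x ⊗ₜ TensorProduct.assoc k W C C (ρW.ρ.rTensor C t)) := by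
      intro t
      induction t with
      | zero => simp
      | tmul w c =>
        simp only [TensorProduct.assoc_symm_tmul, LinearMap.lTensor_tmul, LinearMap.rTensor_tmul,
          LinearMap.comp_apply, LinearEquiv.coe_coe]
        generalize ρW.ρ w = u
        induction u with
        | zero => simp
        | tmul a v => simp
        | add x y hx hy => simp only [map_add, add_tmul, tmul_add, hx, hy]
      | add x y hx hy => simp only [map_add, tmul_add, hx, hy]
    simp only [AlgebraTensorModule.curry_apply, curry_apply, LinearMap.coe_restrictScalars,
      LinearMap.comp_apply, LinearEquiv.coe_coe, LinearMap.lTensor_tmul]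
    rw [h1, h, ← h2]
  counit_id := by
    ext x w
    have h := LinearMap.congr_fun ρW.counit_id w
    simp only [LinearMap.comp_apply, LinearEquiv.coe_coe, LinearMap.id_apply] at h
    have h1 : ∀ t : W ⊗[k] C, TensorProduct.rid k (X ⊗[k] W)
        ((Coalgebra.counit (R := k) (A := C)).lTensor (X ⊗[k] W)
          ((TensorProduct.assoc k X W C).symm (x ⊗ₜ[k] t))) =
        x ⊗ₜ (TensorProduct.rid k W ((Coalgebra.counit (R := k) (A := C)).lTensor W t)) := by
      intro t
      induction t with
      | zero => simp
      | tmul w c => simp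
      | add x y hx hy => simp only [map_add, tmul_add, hx, hy]
    simp only [AlgebraTensorModule.curry_apply, curry_apply, LinearMap.coe_restrictScalars,
      LinearMap.comp_apply, LinearEquiv.coe_coe, LinearMap.lTensor_tmul]
    rw [h1, h]
    rfl

theorem coactLeft_leftTensor (ρW : RComod k C W) (z : (X ⊗[k] W) ⊗[k] V) :
    TensorProduct.assoc k X W (C ⊗[k] V) (coactLeft V (ρW.leftTensor X).ρ z) =
      (coactLeft V ρW.ρ).lTensor X (TensorProduct.assoc k X W V z) := by
  induction z with
  | zero => simp
  | tmul t v =>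
    induction t with
    | zero => simp
    | tmul x w =>
      simp only [coactLeft, RComod.leftTensor, LinearMap.comp_apply, LinearMap.rTensor_tmul,
        LinearMap.lTensor_tmul, LinearEquiv.coe_coe, TensorProduct.assoc_tmul]
      generalize ρW.ρ w = u
      induction u with
      | zero => simp
      | tmul a v => simp
      | add x y hx hy => simp only [map_add, add_tmul, tmul_add, hx, hy]
    | add x y hx hy => simp only [map_add, add_tmul, hx, hy]
  | add x y hx hy => simp only [map_add, hx, hy]

theorem lTensor_leftTensor (f : V →ₗ[k] C ⊗[k] V) (z : (X ⊗[k] W) ⊗[k] V) :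
    TensorProduct.assoc k X W (C ⊗[k] V) (f.lTensor (X ⊗[k] W) z) =
      (f.lTensor W).lTensor X (TensorProduct.assoc k X W V z) := by
  induction z with
  | zero => simp
  | tmul t v =>
    induction t with
    | zero => simp
    | tmul x w => simp
    | add x y hx hy => simp only [map_add, add_tmul, hx, hy]
  | add x y hx hy => simp only [map_add, hx, hy]

/-- Over a field, `(X ⊗ W) □_C V = X ⊗ (W □_C V)`. -/
theorem mem_cotensor_leftTensor {ρW : RComod k C W} {lamV : V →ₗ[k] C ⊗[k] V}
    {z : (X ⊗[k] W) ⊗[k] V} :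
    z ∈ cotensor k (ρW.leftTensor X).ρ lamV ↔ ∃ e : X ⊗[k] cotensor k ρW.ρ lamV,
      (cotensor k ρW.ρ lamV).subtype.lTensor X e = TensorProduct.assoc k X W V z := by
  rw [mem_cotensor, ← (TensorProduct.assoc k X W (C ⊗[k] V)).injective.eq_iff,
    coactLeft_leftTensor, lTensor_leftTensor, ← sub_eq_zero, ← LinearMap.sub_apply,
    ← LinearMap.lTensor_sub]
  exact exact_lTensor_cotensor X ρW.ρ lamV _

end Cotensor

section Coflat

variable {V : Type} [AddCommGroup V] [Module k V]

variable (k C) in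
/-- The coalgebra `C` as a right comodule over itself. -/
noncomputable def comulRComod : RComod k C C where
  ρ := Coalgebra.comul
  coassoc := Coalgebra.coassoc.symm
  counit_id := by
    ext c
    simp

/-- The map `A ⊗ B ⊗ N → A ⊗ N`, `a ⊗ b ⊗ n ↦ ab ⊗ n - a ⊗ bn`. -/
noncomputable def balMap (B : Subalgebra k A) (N : Type) [AddCommGroup N] [Module k N] [Module A N]
    [IsScalarTower k A N] : (A ⊗[k] B) ⊗[k] N →ₗ[k] A ⊗[k] N :=
  (mul' k A ∘ₗ B.val.toLinearMap.lTensor A).rTensor N -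
    (actionMap k A N ∘ₗ B.val.toLinearMap.rTensor N).lTensor A ∘ₗ
      (TensorProduct.assoc k A B N).toLinearMap

theorem balMap_tmul (B : Subalgebra k A) {N : Type} [AddCommGroup N] [Module k N] [Module A N]
    [IsScalarTower k A N] (a : A) (b : B) (n : N) :
    balMap B N ((a ⊗ₜ b) ⊗ₜ n) = (a * b) ⊗ₜ n - a ⊗ₜ ((b : A) • n) := rfl

theorem assoc_balMap_rTensor (B : Subalgebra k A) (z : ((A ⊗[k] B) ⊗[k] A) ⊗[k] V) :
    TensorProduct.assoc k A A V ((balMap B A).rTensor V z) =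
      balMap B (A ⊗[k] V) (TensorProduct.assoc k (A ⊗[k] B) A V z) := by
  suffices h : (TensorProduct.assoc k A A V).toLinearMap ∘ₗ (balMap B A).rTensor V =
      balMap B (A ⊗[k] V) ∘ₗ (TensorProduct.assoc k (A ⊗[k] B) A V).toLinearMap from
    LinearMap.congr_fun h z
  ext a b a' v
  simp [balMap_tmul, sub_tmul, smul_tmul']

theorem balMap_lTensor_subtype {N : Type} [AddCommGroup N] [Module k N] [Module A N]
    [IsScalarTower k A N] {B : Subalgebra k A} {L : Submodule k N}
    (hL : ∀ b ∈ B, ∀ x ∈ L, b • x ∈ L) (w : (A ⊗[k] B) ⊗[k] L) :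
    ∃ e ∈ balRel B L.subtype, L.subtype.lTensor A e = balMap B N (L.subtype.lTensor _ w) := by
  induction w with
  | zero => exact ⟨0, zero_mem _, by simp⟩
  | tmul t x =>
    induction t with
    | zero => exact ⟨0, zero_mem _, by simp⟩
    | tmul a b =>
      exact ⟨_, Submodule.subset_span ⟨a, b, b.2, x, ⟨(b : A) • (x : N), hL b b.2 x x.2⟩, rfl, rfl⟩,
        by simp [balMap_tmul]⟩
    | add x y hx hy =>
      obtain ⟨e, he, he'⟩ := hx
      obtain ⟨f, hf, hf'⟩ := hy
      exact ⟨e + f, add_mem he hf, by simp only [add_tmul, map_add, he', hf']⟩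
  | add x y hx hy =>
    obtain ⟨e, he, he'⟩ := hx
    obtain ⟨f, hf, hf'⟩ := hy
    exact ⟨e + f, add_mem he hf, by simp only [map_add, he', hf']⟩

theorem range_balMap_coinv (ρA : A →ₗ[k] A ⊗[k] C) :
    LinearMap.range (balMap (coinvSubalgebra ρA) A) = relSub k (coinvB k ρA) := by
  apply le_antisymm
  · rintro _ ⟨z, rfl⟩
    induction z with
    | zero => simp
    | tmul t x =>
      induction t with
      | zero => simp
      | tmul a b => exact Submodule.subset_span ⟨a, x, b, b.2, rfl⟩
      | add x y hx hy =>
        rw [add_tmul, map_add]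
        exact add_mem hx hy
    | add x y hx hy =>
      rw [map_add]
      exact add_mem hx hy
  · rw [relSub, Submodule.span_le]
    rintro _ ⟨a, a', b, hb, rfl⟩
    exact ⟨(a ⊗ₜ ⟨b, hb⟩) ⊗ₜ a', rfl⟩

theorem balMap_colinear (ΔA : RComod k C A) :
    (ΔA.leftTensor A).ρ ∘ₗ balMap (coinvSubalgebra ΔA.ρ) A =
      (balMap (coinvSubalgebra ΔA.ρ) A).rTensor C ∘ₗ
        (ΔA.leftTensor (A ⊗[k] coinvSubalgebra ΔA.ρ)).ρ := by
  ext a b a'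
  simp only [RComod.leftTensor, AlgebraTensorModule.curry_apply, curry_apply,
    LinearMap.coe_restrictScalars, LinearMap.comp_apply, LinearEquiv.coe_coe,
    LinearMap.lTensor_tmul, balMap_tmul, map_sub, smul_eq_mul, map_mul_of_mem_coinv b.2]
  generalize ΔA.ρ a' = t
  induction t with
  | zero => simp
  | tmul a c => simp [balMap_tmul, sub_tmul, smul_tmul']
  | add x y hx hy => simp only [map_add, tmul_add, smul_add, ← hx, ← hy, add_sub_add_comm]

theorem canHat_colinear (ΔA : RComod k C A) :
    ((comulRComod k C).leftTensor A).ρ ∘ₗ canHat ΔA.ρ =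
      (canHat ΔA.ρ).rTensor C ∘ₗ (ΔA.leftTensor A).ρ := by
  ext a a'
  have h := LinearMap.congr_fun ΔA.coassoc a'
  simp only [LinearMap.comp_apply, LinearEquiv.coe_coe] at h
  have h1 : ∀ t : A ⊗[k] C,
      (canHat ΔA.ρ).rTensor C ((TensorProduct.assoc k A A C).symm (a ⊗ₜ[k] t)) =
        a • ΔA.ρ.rTensor C t := by
    intro t
    induction t with
    | zero => simp
    | tmul a c => simp [canHat_tmul, smul_tmul']
    | add x y hx hy => simp only [map_add, tmul_add, smul_add, hx, hy]
  have h2 : ∀ t : A ⊗[k] (C ⊗[k] C), (TensorProduct.assoc k A C C).symm (a • t) =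
      a • (TensorProduct.assoc k A C C).symm t := by
    intro t
    induction t with
    | zero => simp
    | tmul a' u =>
      induction u with
      | zero => simp
      | tmul c d => simp [smul_tmul']
      | add x y hx hy => simp only [map_add, tmul_add, smul_add, hx, hy]
    | add x y hx hy => simp only [map_add, smul_add, hx, hy]
  simp only [RComod.leftTensor, comulRComod, AlgebraTensorModule.curry_apply, curry_apply,
    LinearMap.coe_restrictScalars, LinearMap.comp_apply, LinearEquiv.coe_coe,
    LinearMap.lTensor_tmul, canHat_tmul, lTensor_smul_left, h, h1, h2,
    LinearEquiv.symm_apply_apply]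

/-- `A · (A □_C V)` is all of `A ⊗ V` if `V` is coflat. -/
theorem cotensor_generates_of_coflat (ΔA : RComod k C A)
    (hsurj : Function.Surjective (canHat ΔA.ρ))
    (lamV : LComod k C V) (hV : IsCoflat k lamV.ρ) (y : A ⊗[k] V) :
    ∃ e : A ⊗[k] cotensor k ΔA.ρ lamV.ρ,
      actionMap k A _ ((cotensor k ΔA.ρ lamV.ρ).subtype.lTensor A e) = y := by
  have h := hV _ _ _ ((comulRComod k C).leftTensor A) (ΔA.leftTensor A) ΔA (canHat ΔA.ρ) 0
    (canHat_colinear ΔA) (by simp) (by rw [LinearMap.range_eq_top.2 hsurj, LinearMap.ker_zero])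
  have hy : (TensorProduct.assoc k A C V).symm (lamV.ρ.lTensor A y) ∈
      cotensor k ((comulRComod k C).leftTensor A).ρ lamV.ρ := by
    rw [mem_cotensor, ← (TensorProduct.assoc k A C (C ⊗[k] V)).injective.eq_iff,
      coactLeft_leftTensor, lTensor_leftTensor, LinearEquiv.apply_symm_apply,
      ← LinearMap.comp_apply, ← LinearMap.comp_apply, ← LinearMap.lTensor_comp,
      ← LinearMap.lTensor_comp]
    congr 2
    ext v
    exact lamV.coactLeft_comul v
  obtain ⟨z, hz, hzy⟩ := h.ge ⟨hy, by simp⟩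
  obtain ⟨e, he⟩ := mem_cotensor_leftTensor.1 hz
  refine ⟨e, lamV.lTensor_injective A ?_⟩
  rw [← canLeft_lTensor_cotensor, he, canLeft_assoc, hzy, LinearEquiv.apply_symm_apply]

/-- If `V` is coflat, `A ⊗_B (A □_C V) → A ⊗ V` is injective. -/
theorem mem_balRel_cotensor_of_coflat (ΔA : RComod k C A)
    (hker : LinearMap.ker (canHat ΔA.ρ) = relSub k (coinvB k ΔA.ρ))
    (lamV : LComod k C V) (hV : IsCoflat k lamV.ρ)
    (e : A ⊗[k] cotensor k ΔA.ρ lamV.ρ)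
    (he : actionMap k A _ ((cotensor k ΔA.ρ lamV.ρ).subtype.lTensor A e) = 0) :
    e ∈ balRel (N := A ⊗[k] V) (L := cotensor k ΔA.ρ lamV.ρ) (coinvSubalgebra ΔA.ρ)
      (cotensor k ΔA.ρ lamV.ρ).subtype := by
  have h := hV _ _ _ (ΔA.leftTensor A) (ΔA.leftTensor (A ⊗[k] coinvSubalgebra ΔA.ρ))
    ((comulRComod k C).leftTensor A) (balMap (coinvSubalgebra ΔA.ρ) A) (canHat ΔA.ρ)
    (balMap_colinear ΔA) (canHat_colinear ΔA) (by rw [range_balMap_coinv, hker])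
  obtain ⟨z, hz⟩ := (TensorProduct.assoc k A A V).surjective
    ((cotensor k ΔA.ρ lamV.ρ).subtype.lTensor A e)
  have hz0 : (canHat ΔA.ρ).rTensor V z = 0 := by
    rw [← LinearEquiv.map_eq_zero_iff (TensorProduct.assoc k A C V), ← canLeft_assoc, hz,
      canLeft_lTensor_cotensor, he, map_zero]
  obtain ⟨w, hw, hwz⟩ := h.ge ⟨mem_cotensor_leftTensor.2 ⟨e, hz.symm⟩, hz0⟩
  obtain ⟨w', hw'⟩ := mem_cotensor_leftTensor.1 hw
  obtain ⟨e', he', hee'⟩ := balMap_lTensor_subtype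
    (fun b hb x hx => smul_mem_cotensor (ρA := ΔA.ρ) lamV.ρ hb hx) w'
  rw [hw', ← assoc_balMap_rTensor, hwz, hz] at hee'
  rwa [← Module.Flat.lTensor_preserves_injective_linearMap (M := A) _
    (Submodule.injective_subtype _) hee']

end Coflat

section CrossSections

variable {V : Type} [AddCommGroup V] [Module k V]

theorem actionMap_self : actionMap k A A = mul' k A := by
  ext
  rfl

theorem entwAct_tmul (E : Entwining k A C) (a a' : A) (c : C) :
    entwAct E (mul' k A) ((a ⊗ₜ c) ⊗ₜ a') = a • E.ψ (c ⊗ₜ a') := by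
  simp only [entwAct, LinearMap.comp_apply, LinearMap.lTensor_tmul, LinearEquiv.coe_coe,
    TensorProduct.assoc_tmul]
  generalize E.ψ (c ⊗ₜ a') = t
  induction t with
  | zero => simp
  | tmul a v => simp [smul_tmul']
  | add x y hx hy => simp only [map_add, tmul_add, smul_add, hx, hy]

theorem EntwCompat.map_mul {E : Entwining k A C} {ΔA : RComod k C A}
    (hE : EntwCompat E (mulRAct k A) ΔA) (a a' : A) :
    ΔA.ρ (a * a') = entwAct E (mul' k A) (ΔA.ρ a ⊗ₜ a') :=
  LinearMap.congr_fun hE (a ⊗ₜ a')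

theorem EntwCompat.mem_coinv_iff {E : Entwining k A C} {ΔA : RComod k C A}
    (hE : EntwCompat E (mulRAct k A) ΔA) {b : A} :
    b ∈ coinvB k ΔA.ρ ↔ ΔA.ρ b = b • ΔA.ρ 1 := by
  refine ⟨fun hb => by simpa [mulLeft_rTensor] using hb 1, fun hb a => ?_⟩
  have h : ∀ t : A ⊗[k] C, entwAct E (mul' k A) ((b • t) ⊗ₜ a) =
      b • entwAct E (mul' k A) (t ⊗ₜ a) := by
    intro t
    induction t with
    | zero => simp
    | tmul a v => simp [smul_tmul', entwAct_tmul, mul_smul]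
    | add x y hx hy => simp only [map_add, add_tmul, smul_add, hx, hy]
  rw [mulLeft_rTensor, hE.map_mul, hb, h, ← hE.map_mul, one_mul]

theorem EntwCompat.map_actionMap {E : Entwining k A C} {ΔA : RComod k C A}
    (hE : EntwCompat E (mulRAct k A) ΔA) (φ : V →ₗ[k] A) (x : A ⊗[k] V) :
    ΔA.ρ (actionMap k A A (φ.lTensor A x)) =
      actionMap k A (A ⊗[k] C) ((E.ψ ∘ₗ φ.lTensor C).lTensor A (coactLeft V ΔA.ρ x)) := by
  induction x with
  | zero => simp
  | tmul a v =>
    simp only [LinearMap.lTensor_tmul, actionMap_tmul, smul_eq_mul, hE.map_mul, coactLeft,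
      LinearMap.comp_apply, LinearMap.rTensor_tmul, LinearEquiv.coe_coe]
    generalize ΔA.ρ a = t
    induction t with
    | zero => simp
    | tmul a v => simp [entwAct_tmul]
    | add x y hx hy => simp only [map_add, add_tmul, hx, hy]
  | add x y hx hy => simp only [map_add, hx, hy]

theorem EntwCompat.map_actionMap_of_mem_cotensor {E : Entwining k A C} {ΔA : RComod k C A}
    (hE : EntwCompat E (mulRAct k A) ΔA) (φ : V →ₗ[k] A) {lamV : V →ₗ[k] C ⊗[k] V}
    {x : A ⊗[k] V} (hx : x ∈ cotensor k ΔA.ρ lamV) :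
    ΔA.ρ (actionMap k A A (φ.lTensor A x)) =
      actionMap k A (A ⊗[k] C) ((E.ψ ∘ₗ φ.lTensor C ∘ₗ lamV).lTensor A x) := by
  rw [hE.map_actionMap, mem_cotensor.1 hx, ← LinearMap.comp_assoc, LinearMap.lTensor_comp _ _ lamV,
    LinearMap.comp_apply]

/-- Linear maps out of `V` which induce the same map on a generating subspace of `A ⊗ V` agree. -/
theorem eq_of_actionMap_eqOn {N : Type} [AddCommGroup N] [Module k N] [Module A N]
    [IsScalarTower k A N] {L : Submodule k (A ⊗[k] V)}
    (hL : ∀ y, ∃ e : A ⊗[k] L, actionMap k A _ (L.subtype.lTensor A e) = y) {p q : V →ₗ[k] N}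
    (h : ∀ x ∈ L, actionMap k A N (p.lTensor A x) = actionMap k A N (q.lTensor A x)) : p = q := by
  ext v
  have key : ∀ e : A ⊗[k] L,
      actionMap k A N (p.lTensor A (actionMap k A _ (L.subtype.lTensor A e))) =
      actionMap k A N (q.lTensor A (actionMap k A _ (L.subtype.lTensor A e))) := by
    intro e
    induction e with
    | zero => simp
    | tmul a x =>
      simp [lTensor_smul_left, actionMap_smul, h x x.2]
    | add x y hx hy => simp only [map_add, hx, hy]
  obtain ⟨e, he⟩ := hL (1 ⊗ₜ v)
  simpa [he] using key e

/-- If `A ⊗_B L → A ⊗ V` is bijective, every `B`-linear map `L → A` is induced by a linear map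
`V → A`. -/
theorem exists_actionMap_eq {B : Subalgebra k A} {L : Submodule k (A ⊗[k] V)}
    (hL : ∀ y, ∃ e : A ⊗[k] L, actionMap k A _ (L.subtype.lTensor A e) = y)
    (hinj : ∀ e : A ⊗[k] L, actionMap k A _ (L.subtype.lTensor A e) = 0 →
      e ∈ balRel (N := A ⊗[k] V) (L := L) B L.subtype)
    (s : L →ₗ[k] A)
    (hs : ∀ b ∈ B, ∀ x y : L, (y : A ⊗[k] V) = b • (x : A ⊗[k] V) → s y = b * s x) :
    ∃ φ : V →ₗ[k] A, ∀ x : L, actionMap k A A (φ.lTensor A x) = s x := by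
  let m : A ⊗[k] L →ₗ[k] A ⊗[k] V := actionMap k A _ ∘ₗ L.subtype.lTensor A
  let sA : A ⊗[k] L →ₗ[k] A := actionMap k A A ∘ₗ s.lTensor A
  obtain ⟨σ, hσ⟩ := LinearMap.exists_rightInverse_of_surjective m (LinearMap.range_eq_top.2 hL)
  have hbal : balRel (N := A ⊗[k] V) (L := L) B L.subtype ≤ LinearMap.ker sA := by
    rw [balRel, Submodule.span_le]
    rintro _ ⟨a, b, hb, x, y, hxy, rfl⟩
    simp [sA, hs b hb x y hxy, mul_assoc]
  let t : A ⊗[k] V →ₗ[k] A := sA ∘ₗ σ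
  have ht : ∀ e, t (m e) = sA e := by
    intro e
    rw [← sub_eq_zero]
    change sA (σ (m e)) - sA e = 0
    rw [← map_sub]
    refine hbal (hinj _ ?_)
    change m (σ (m e) - e) = 0
    rw [map_sub, sub_eq_zero]
    exact LinearMap.congr_fun hσ (m e)
  have ht_smul : ∀ (a : A) y, t (a • y) = a • t y := by
    intro a y
    obtain ⟨e, rfl⟩ := hL y
    have h1 : a • m e = m (a • e) := by
      simp only [m, LinearMap.comp_apply, lTensor_smul_left, actionMap_smul]
    have h2 : sA (a • e) = a • sA e := by
      simp only [sA, LinearMap.comp_apply, lTensor_smul_left, actionMap_smul]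
    change t (a • m e) = a • t (m e)
    rw [h1, ht, ht, h2]
  refine ⟨t ∘ₗ TensorProduct.mk k A V 1, fun x => ?_⟩
  have h : ∀ y : A ⊗[k] V,
      actionMap k A A ((t ∘ₗ TensorProduct.mk k A V 1).lTensor A y) = t y := by
    intro y
    induction y with
    | zero => simp
    | tmul a v =>
      rw [LinearMap.lTensor_tmul, actionMap_tmul, LinearMap.comp_apply, ← ht_smul,
        TensorProduct.mk_apply, smul_tmul', smul_eq_mul, mul_one]
    | add x y hx hy => simp only [map_add, hx, hy]
  have h1 := ht (1 ⊗ₜ x)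
  rw [h]
  simpa [m, sA] using h1

end CrossSections

/-- for a `C`-Galois extension `A(B)^C` with canonical entwining map
`ψ`, a left `C`-comodule `V` and `E = A □_C V`, if `A` is flat as a right
`B`-module or `V` is coflat as a left `C`-comodule, then the right `B`-module of
cross-sections `Hom_{B-}(E,B)` is isomorphic to `Hom_ψ(V,A)`, via
`φ ↦ (Σᵢ aⁱ⊗vⁱ ↦ Σᵢ aⁱφ(vⁱ))`. -/
theorem statement17 {k A C V : Type} [Field k] [Ring A] [Algebra k A]
    [AddCommGroup C] [Module k C] [Coalgebra k C] [AddCommGroup V] [Module k V]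
    (ΔA : RComod k C A)
    (hsurj : Function.Surjective (canHat ΔA.ρ))
    (hker : LinearMap.ker (canHat ΔA.ρ) = relSub k (coinvB k ΔA.ρ))
    (E : Entwining k A C) (hE : EntwCompat E (mulRAct k A) ΔA)
    (lamV : LComod k C V)
    (hyp : FlatRightOver k (coinvB k ΔA.ρ) ∨ IsCoflat k lamV.ρ) :
    let Ecot : Submodule k (A ⊗[k] V) := cotensor k ΔA.ρ lamV.ρ
    let Homψ : (V →ₗ[k] A) → Prop := fun φ => ∀ v : V,
      E.ψ (φ.lTensor C (lamV.ρ v)) = (LinearMap.mulLeft k (φ v)).rTensor C (ΔA.ρ 1)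
    let Θ : (V →ₗ[k] A) → (↥Ecot →ₗ[k] A) := fun φ =>
      mul' k A ∘ₗ φ.lTensor A ∘ₗ Ecot.subtype
    -- cross-sections: `B`-valued left `B`-linear maps on `E`
    let Sect : (↥Ecot →ₗ[k] A) → Prop := fun s =>
      (∀ x : Ecot, s x ∈ coinvB k ΔA.ρ) ∧
      ∀ b ∈ coinvB k ΔA.ρ, ∀ x y : Ecot,
        (y : A ⊗[k] V) = (LinearMap.mulLeft k b).rTensor V (x : A ⊗[k] V) →
        s y = b * s x
    -- `Θ` is a bijection from `Hom_ψ(V,A)` onto the cross-sections: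
    (∀ φ, Homψ φ → Sect (Θ φ)) ∧
    (∀ φ φ', Homψ φ → Homψ φ' → Θ φ = Θ φ' → φ = φ') ∧
    (∀ s, Sect s → ∃ φ, Homψ φ ∧ Θ φ = s) ∧
    -- `Θ` is right `B`-linear:
    (∀ φ, Homψ φ → ∀ b ∈ coinvB k ΔA.ρ,
      Θ (LinearMap.mulRight k b ∘ₗ φ) = LinearMap.mulRight k b ∘ₗ Θ φ) := by
  intro Ecot Homψ Θ Sect
  have hgen : ∀ y, ∃ e : A ⊗[k] Ecot, actionMap k A _ (Ecot.subtype.lTensor A e) = y := by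
    rcases hyp with h | h
    · exact cotensor_generates_of_flat ΔA hsurj hker lamV h
    · exact cotensor_generates_of_coflat ΔA hsurj lamV h
  have hinj : ∀ e : A ⊗[k] Ecot, actionMap k A _ (Ecot.subtype.lTensor A e) = 0 →
      e ∈ balRel (N := A ⊗[k] V) (L := Ecot) (coinvSubalgebra ΔA.ρ) Ecot.subtype := by
    rcases hyp with h | h
    · exact mem_balRel_cotensor_of_flat ΔA hsurj hker lamV h
    · exact mem_balRel_cotensor_of_coflat ΔA hker lamV h
  have hΘ : ∀ φ (x : Ecot), Θ φ x = actionMap k A A (φ.lTensor A (x : A ⊗[k] V)) := by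
    intro φ x
    rw [actionMap_self]
    rfl
  -- the map `V → A ⊗ C`, `v ↦ φ(v) 1₍₀₎ ⊗ 1₍₁₎`
  let r : A →ₗ[k] A ⊗[k] C := actionMap k A (A ⊗[k] C) ∘ₗ (TensorProduct.mk k A _).flip (ΔA.ρ 1)
  have hr : ∀ a, r a = a • ΔA.ρ 1 := fun _ => rfl
  have hHom : ∀ φ, Homψ φ ↔ E.ψ ∘ₗ φ.lTensor C ∘ₗ lamV.ρ = r ∘ₗ φ := by
    intro φ
    rw [LinearMap.ext_iff]
    refine forall_congr' fun v => ?_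
    rw [mulLeft_rTensor]
    rfl
  have hact : ∀ (φ : V →ₗ[k] A) (x : A ⊗[k] V),
      actionMap k A _ ((r ∘ₗ φ).lTensor A x) = actionMap k A A (φ.lTensor A x) • ΔA.ρ 1 := by
    intro φ x
    rw [LinearMap.lTensor_comp, LinearMap.comp_apply, ← hr]
    exact actionMap_lTensor r (fun a n => by rw [hr, hr, smul_assoc]) _
  refine ⟨fun φ hφ => ⟨fun x => ?_, fun b hb x y hxy => ?_⟩, fun φ φ' _ _ h => ?_, fun s hs => ?_,
    fun φ _ b _ => ?_⟩
  · rw [hE.mem_coinv_iff, hΘ, hE.map_actionMap_of_mem_cotensor φ x.2, (hHom φ).1 hφ, hact]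
  · rw [hΘ, hΘ, hxy, mulLeft_rTensor, lTensor_smul_left, actionMap_smul, smul_eq_mul]
  · refine eq_of_actionMap_eqOn hgen fun x hx => ?_
    rw [← hΘ φ ⟨x, hx⟩, h, hΘ]
  · obtain ⟨φ, hφ⟩ := exists_actionMap_eq hgen hinj s fun b hb x y hxy =>
      hs.2 b hb x y (by rw [hxy, mulLeft_rTensor])
    refine ⟨φ, (hHom φ).2 (eq_of_actionMap_eqOn hgen fun x hx => ?_),
      LinearMap.ext fun x => (hΘ φ x).trans (hφ x)⟩
    rw [← hE.map_actionMap_of_mem_cotensor φ hx, hact]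
    refine hE.mem_coinv_iff.1 ?_
    rw [hφ ⟨x, hx⟩]
    exact hs.1 _
  · ext x
    refine (hΘ _ x).trans ?_
    rw [LinearMap.comp_apply, hΘ, LinearMap.lTensor_comp, LinearMap.comp_apply]
    exact actionMap_lTensor _ (fun a n => mul_assoc a n b) _
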